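/- Let Z be a real M1×N matrix and Y a real M2×N matrix, and let P_N = I_N − (1/N)·1_N 1_Nᵀ. Assume Z P_N Zᵀ, Y P_N Yᵀ, and Z P_N(I_N − P_{Ny})P_N Zᵀ are all invertible, where P_{Ny} = (Y P_N)ᵀ(Y P_N Yᵀ)⁻¹(Y P_N). Let S_{zy} = (Z P_N Zᵀ)⁻¹(Z P_N Yᵀ)(Y P_N Yᵀ)⁻¹(Z P_N Yᵀ)ᵀ. Then Z P_N Yᵀ(Y P_N Yᵀ)⁻¹Y P_N Zᵀ = Z P_N P_{Ny} P_N Zᵀ, every eigenvalue γ of S_{zy} lies in [0,1), and γ ∈ [0,1) is an eigenvalue of S_{zy} if and only if γ/(1−γ) is an eigenvalue of (Z P_N(I_N − P_{Ny})P_N Zᵀ)⁻¹ Z P_N P_{Ny} P_N Zᵀ. In particular, if γ₁ is the largest eigenvalue of S_{zy}, then λ₁ = γ₁/(1−γ₁) is the largest eigenvalue of (Z P_N(I_N − P_{Ny})P_N Zᵀ)⁻¹ Z P_N P_{Ny} P_N Zᵀ. -/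

import Mathlib

open Matrix

/-- The `k × k` matrix of all ones. -/
def onesMat (k : ℕ) : Matrix (Fin k) (Fin k) ℝ := Matrix.of fun _ _ => (1 : ℝ)

/-- `μ` is an eigenvalue of the real matrix `M`. -/
def hasEigen {n : Type*} [Fintype n] (M : Matrix n n ℝ) (μ : ℝ) : Prop :=
  ∃ v : n → ℝ, v ≠ 0 ∧ M.mulVec v = μ • v

theorem onesMat_transpose (k : ℕ) : (onesMat k)ᵀ = onesMat k := rfl

theorem onesMat_mul_self (k : ℕ) : onesMat k * onesMat k = (k : ℝ) • onesMat k := by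
  ext i j
  simp [onesMat, Matrix.mul_apply]

theorem centering_transpose (k : ℕ) :
    (1 - (k : ℝ)⁻¹ • onesMat k)ᵀ = 1 - (k : ℝ)⁻¹ • onesMat k := by
  simp [onesMat_transpose]

theorem centering_mul_self (k : ℕ) :
    (1 - (k : ℝ)⁻¹ • onesMat k) * (1 - (k : ℝ)⁻¹ • onesMat k) = 1 - (k : ℝ)⁻¹ • onesMat k := by
  rcases Nat.eq_zero_or_pos k with rfl | hk
  · ext i
    exact i.elim0
  · have hk' : (k : ℝ) ≠ 0 := by positivity
    simp [mul_sub, sub_mul, onesMat_mul_self, smul_smul, hk']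

theorem posSemidef_conj_of_symm_idempotent {m n : Type*} [Fintype m] [Fintype n]
    (W : Matrix m n ℝ) (Q : Matrix n n ℝ) (hQt : Qᵀ = Q) (hQ : Q * Q = Q) :
    (W * Q * Wᵀ).PosSemidef := by
  have h : W * Q * Wᵀ = (W * Q) * (W * Q)ᴴ := by
    rw [conjTranspose_eq_transpose_of_trivial, transpose_mul, hQt, ← Matrix.mul_assoc,
      Matrix.mul_assoc W Q Q, hQ]
  rw [h]
  exact posSemidef_self_mul_conjTranspose _

theorem nonsing_inv_mul_mulVec_eq_smul_iff {n : Type*} [Fintype n] [DecidableEq n]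
    {A B : Matrix n n ℝ} (hA : IsUnit A.det) (μ : ℝ) (v : n → ℝ) :
    (A⁻¹ * B) *ᵥ v = μ • v ↔ B *ᵥ v = μ • A *ᵥ v := by
  constructor
  · intro h
    have h' := congrArg (A *ᵥ ·) h
    simpa [mulVec_mulVec, ← Matrix.mul_assoc, mul_nonsing_inv _ hA, mulVec_smul] using h'
  · intro h
    rw [← mulVec_mulVec, h, mulVec_smul, mulVec_mulVec, nonsing_inv_mul _ hA, one_mulVec]

theorem hasEigen_nonsing_inv_mul_nonneg {n : Type*} [Fintype n] [DecidableEq n]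
    {B C : Matrix n n ℝ} (hB : B.PosSemidef) (hC : C.PosDef) {μ : ℝ}
    (h : hasEigen (C⁻¹ * B) μ) : 0 ≤ μ := by
  obtain ⟨v, hv, h⟩ := h
  rw [nonsing_inv_mul_mulVec_eq_smul_iff hC.det_pos.ne'.isUnit] at h
  have hb := hB.dotProduct_mulVec_nonneg v
  have hc := hC.dotProduct_mulVec_pos hv
  rw [h, dotProduct_smul, smul_eq_mul] at hb
  exact nonneg_of_mul_nonneg_left hb hc

theorem hasEigen_add_nonsing_inv_mul_lt_one {n : Type*} [Fintype n] [DecidableEq n]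
    {B C : Matrix n n ℝ} (hB : B.PosSemidef) (hC : C.PosDef) {μ : ℝ}
    (h : hasEigen ((B + C)⁻¹ * B) μ) : μ < 1 := by
  have hA : (B + C).PosDef := hC.posSemidef_add hB
  obtain ⟨v, hv, h⟩ := h
  rw [nonsing_inv_mul_mulVec_eq_smul_iff hA.det_pos.ne'.isUnit] at h
  have hb := hB.dotProduct_mulVec_nonneg v
  have hc := hC.dotProduct_mulVec_pos hv
  have h' := congrArg (star v ⬝ᵥ ·) h
  simp only [add_mulVec, dotProduct_smul, dotProduct_add, smul_eq_mul] at h'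
  by_contra! hμ
  nlinarith

theorem hasEigen_add_nonsing_inv_mul_iff {n : Type*} [Fintype n] [DecidableEq n]
    {B C : Matrix n n ℝ} (hA : IsUnit (B + C).det) (hC : IsUnit C.det) {γ : ℝ} (hγ : γ ≠ 1) :
    hasEigen ((B + C)⁻¹ * B) γ ↔ hasEigen (C⁻¹ * B) (γ / (1 - γ)) := by
  have h1 : 1 - γ ≠ 0 := sub_ne_zero.mpr hγ.symm
  refine exists_congr fun v => and_congr_right fun _ => ?_
  rw [nonsing_inv_mul_mulVec_eq_smul_iff hA, nonsing_inv_mul_mulVec_eq_smul_iff hC, funext_iff,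
    funext_iff]
  refine forall_congr' fun i => ?_
  simp only [add_mulVec, Pi.smul_apply, Pi.add_apply, smul_eq_mul]
  rw [div_mul_eq_mul_div, eq_div_iff h1]
  constructor <;> intro h <;> linarith

/-- identification of the CCA matrix `S_{zy}` with the unified matrix:
`Z P_N Yᵀ (Y P_N Yᵀ)⁻¹ Y P_N Zᵀ = Z P_N P_{Ny} P_N Zᵀ`; every eigenvalue of `S_{zy}`
lies in `[0,1)`; `γ ∈ [0,1)` is an eigenvalue of `S_{zy}` iff `γ/(1−γ)` is an
eigenvalue of `(Z P_N(I−P_{Ny})P_N Zᵀ)⁻¹ Z P_N P_{Ny} P_N Zᵀ`; in particular the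
largest eigenvalue `γ₁` of `S_{zy}` gives the largest eigenvalue `γ₁/(1−γ₁)`. -/
theorem stmt_17 {M1 M2 N : ℕ}
    (Z : Matrix (Fin M1) (Fin N) ℝ) (Y : Matrix (Fin M2) (Fin N) ℝ)
    (PN : Matrix (Fin N) (Fin N) ℝ)
    (hPN : PN = 1 - ((N : ℝ))⁻¹ • onesMat N)
    (PNy : Matrix (Fin N) (Fin N) ℝ)
    (hPNy : PNy = (Y * PN)ᵀ * (Y * PN * Yᵀ)⁻¹ * (Y * PN))
    (hZinv : IsUnit (Z * PN * Zᵀ).det)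
    (hYinv : IsUnit (Y * PN * Yᵀ).det)
    (hΩinv : IsUnit (Z * PN * (1 - PNy) * PN * Zᵀ).det)
    (S : Matrix (Fin M1) (Fin M1) ℝ)
    (hS : S = (Z * PN * Zᵀ)⁻¹ * (Z * PN * Yᵀ) * (Y * PN * Yᵀ)⁻¹ * (Z * PN * Yᵀ)ᵀ)
    (Ω : Matrix (Fin M1) (Fin M1) ℝ)
    (hΩ : Ω = (Z * PN * (1 - PNy) * PN * Zᵀ)⁻¹ * (Z * PN * PNy * PN * Zᵀ)) :
    Z * PN * Yᵀ * (Y * PN * Yᵀ)⁻¹ * (Y * PN * Zᵀ) = Z * PN * PNy * PN * Zᵀ ∧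
    (∀ γ : ℝ, hasEigen S γ → 0 ≤ γ ∧ γ < 1) ∧
    (∀ γ : ℝ, 0 ≤ γ → γ < 1 → (hasEigen S γ ↔ hasEigen Ω (γ / (1 - γ)))) ∧
    (∀ γ₁ : ℝ, hasEigen S γ₁ → (∀ γ : ℝ, hasEigen S γ → γ ≤ γ₁) →
      hasEigen Ω (γ₁ / (1 - γ₁)) ∧
        ∀ lam : ℝ, hasEigen Ω lam → lam ≤ γ₁ / (1 - γ₁)) := by
  have hPt : PNᵀ = PN := by rw [hPN, centering_transpose]
  have hPP : PN * PN = PN := by rw [hPN, centering_mul_self]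
  have hGt : ((Y * PN * Yᵀ)⁻¹)ᵀ = (Y * PN * Yᵀ)⁻¹ := by
    rw [transpose_nonsing_inv]
    simp [transpose_mul, hPt, Matrix.mul_assoc]
  clear hPN
  have hGG := nonsing_inv_mul _ hYinv
  generalize (Y * PN * Yᵀ)⁻¹ = G at *
  have hPNy' : PNy = PN * Yᵀ * G * Y * PN := by
    rw [hPNy, transpose_mul, hPt]
    simp only [Matrix.mul_assoc]
  have hQt : PNyᵀ = PNy := by
    rw [hPNy']
    simp only [transpose_mul, transpose_transpose, hPt, hGt, Matrix.mul_assoc]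
  have hPQ : PN * PNy = PNy := by
    simp only [hPNy', ← Matrix.mul_assoc, hPP]
  have hQP : PNy * PN = PNy := by
    simp only [hPNy', Matrix.mul_assoc, hPP]
  have hQQ : PNy * PNy = PNy := by
    calc PNy * PNy = PNy * PN * Yᵀ * G * Y * PN := by
          nth_rewrite 2 [hPNy']
          simp only [Matrix.mul_assoc]
      _ = PN * Yᵀ * (G * (Y * PN * Yᵀ)) * G * Y * PN := by
          rw [hQP]
          nth_rewrite 1 [hPNy']
          simp only [Matrix.mul_assoc]
      _ = PNy := by rw [hGG, Matrix.mul_one, hPNy']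
  have hBeq : Z * PN * Yᵀ * G * (Y * PN * Zᵀ) = Z * PN * PNy * PN * Zᵀ := by
    rw [Matrix.mul_assoc Z PN PNy, hPQ, Matrix.mul_assoc Z PNy PN, hQP, hPNy']
    simp only [Matrix.mul_assoc]
  have hAeq : Z * PN * Zᵀ =
      Z * PN * PNy * PN * Zᵀ + Z * PN * (1 - PNy) * PN * Zᵀ := by
    rw [← Matrix.add_mul, ← Matrix.add_mul, ← Matrix.mul_add, add_sub_cancel, Matrix.mul_one,
      Matrix.mul_assoc Z PN PN, hPP]
  have hconj (Q : Matrix (Fin N) (Fin N) ℝ) :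
      Z * PN * Q * PN * Zᵀ = Z * PN * Q * (Z * PN)ᵀ := by
    rw [transpose_mul, hPt]
    simp only [Matrix.mul_assoc]
  have hB : (Z * PN * PNy * PN * Zᵀ).PosSemidef := by
    rw [hconj]
    exact posSemidef_conj_of_symm_idempotent _ _ hQt hQQ
  have hC : (Z * PN * (1 - PNy) * PN * Zᵀ).PosDef := by
    have hpsd : (Z * PN * (1 - PNy) * PN * Zᵀ).PosSemidef := by
      rw [hconj]
      exact posSemidef_conj_of_symm_idempotent _ _ (by simp [hQt])
        (by simp [mul_sub, sub_mul, hQQ])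
    exact hpsd.posDef_iff_isUnit.mpr ((isUnit_iff_isUnit_det _).mpr hΩinv)
  have hS' : S = (Z * PN * Zᵀ)⁻¹ * (Z * PN * PNy * PN * Zᵀ) := by
    rw [hS, ← hBeq]
    simp only [transpose_mul, transpose_transpose, hPt, Matrix.mul_assoc]
  refine ⟨hBeq, ?_⟩
  rw [hAeq] at hZinv hS'
  clear hAeq hBeq hconj hS
  generalize Z * PN * PNy * PN * Zᵀ = B at *
  generalize Z * PN * (1 - PNy) * PN * Zᵀ = C at *
  subst hS' hΩ
  have hrange (γ : ℝ) (h : hasEigen ((B + C)⁻¹ * B) γ) : 0 ≤ γ ∧ γ < 1 :=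
    ⟨hasEigen_nonsing_inv_mul_nonneg hB (hC.posSemidef_add hB) h,
      hasEigen_add_nonsing_inv_mul_lt_one hB hC h⟩
  refine ⟨hrange, fun γ _ hγ => hasEigen_add_nonsing_inv_mul_iff hZinv hΩinv hγ.ne, ?_⟩
  intro γ₁ h₁ hmax
  have hlt := (hrange γ₁ h₁).2
  refine ⟨(hasEigen_add_nonsing_inv_mul_iff hZinv hΩinv hlt.ne).mp h₁, fun lam hlam => ?_⟩
  have hlam0 := hasEigen_nonsing_inv_mul_nonneg hB hC hlam
  have hpos : 0 < 1 + lam := by linarith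
  have hne : lam / (1 + lam) ≠ 1 := by
    rw [Ne, div_eq_one_iff_eq hpos.ne']
    linarith
  have hback : lam / (1 + lam) / (1 - lam / (1 + lam)) = lam := by
    field_simp
    ring
  have hle := hmax _ ((hasEigen_add_nonsing_inv_mul_iff hZinv hΩinv hne).mpr (by rwa [hback]))
  rw [div_le_iff₀ hpos] at hle
  rw [le_div_iff₀ (by linarith)]
  linarith
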